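/- arXiv:2512.15550 — 2 statements merged into one kernel-verified Lean document; each statement's English description precedes it below -/
import Mathlib

section
/- Let n be a natural number, σ a permutation of Fin n, and t the number of inversions of σ viewed as a rearrangement of a strictly decreasing array, i.e. t = |{(i, j) : i < j and σ⁻¹(j) < σ⁻¹(i)}|. Fix m with 1 ≤ m ≤ n and let s = |{i : i < m and σ⁻¹(i) ≥ m}|. Then every pair (i, j) with i < m ≤ j, σ⁻¹(i) ≥ m and σ⁻¹(j) < m is an inversion, and consequently s² ≤ t. -/
/-- A permutation moves as many points out of a finite subset as it moves into it. -/
theorem Equiv.Perm.card_filter_and_not_comm {α : Type*} [Fintype α] (e : Equiv.Perm α)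
    (p : α → Prop) [DecidablePred p] :
    (Finset.univ.filter fun a => p a ∧ ¬ p (e a)).card =
      (Finset.univ.filter fun a => p (e a) ∧ ¬ p a).card := by
  classical
  have h : (Finset.univ.filter fun a => p a).card =
      (Finset.univ.filter fun a => p (e a)).card :=
    (Finset.card_equiv e (by simp)).symm
  simpa only [Finset.filter_and_not] using Finset.card_sdiff_comm h

/-- Every pair `(i, j)` with `i < m ≤ j`, `σ⁻¹ i ≥ m`, `σ⁻¹ j < m` is an inversion of the
rearrangement given by `σ`, and consequently `s² ≤ t`, where `s` is the number of indices
`i < m` with `σ⁻¹ i ≥ m` and `t` is the total number of inversions. -/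
theorem inversion_pairs_and_sq_le (n : ℕ) (σ : Equiv.Perm (Fin n))
    (m : ℕ) (hm1 : 1 ≤ m) (hmn : m ≤ n) :
    (∀ i j : Fin n, (i : ℕ) < m → m ≤ (j : ℕ) →
        m ≤ ((σ⁻¹ i : Fin n) : ℕ) → ((σ⁻¹ j : Fin n) : ℕ) < m →
        i < j ∧ σ⁻¹ j < σ⁻¹ i) ∧
      (Finset.univ.filter fun i : Fin n =>
          (i : ℕ) < m ∧ m ≤ ((σ⁻¹ i : Fin n) : ℕ)).card ^ 2 ≤
        (Finset.univ.filter fun p : Fin n × Fin n =>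
          p.1 < p.2 ∧ σ⁻¹ p.2 < σ⁻¹ p.1).card := by
  have inv : ∀ i j : Fin n, (i : ℕ) < m → m ≤ (j : ℕ) →
      m ≤ ((σ⁻¹ i : Fin n) : ℕ) → ((σ⁻¹ j : Fin n) : ℕ) < m →
      i < j ∧ σ⁻¹ j < σ⁻¹ i := fun i j hi hj hi' hj' =>
    ⟨Fin.lt_def.2 (hi.trans_le hj), Fin.lt_def.2 (hj'.trans_le hi')⟩
  refine ⟨inv, ?_⟩
  have h := Equiv.Perm.card_filter_and_not_comm σ⁻¹ fun i : Fin n => (i : ℕ) < m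
  simp only [not_lt] at h
  rw [sq]
  nth_rewrite 2 [h]
  rw [← Finset.card_product]
  refine Finset.card_le_card fun p hp => ?_
  simp only [Finset.mem_product, Finset.mem_filter, Finset.mem_univ, true_and] at hp ⊢
  exact inv p.1 p.2 hp.1.1 hp.2.2 hp.1.2 hp.2.1
end

section
/- Let E be a real inner product space, let K₁, …, K_N ∈ E be nonzero vectors, and let Q ∈ E be nonzero such that the cosine similarities cos(Q, K₁), …, cos(Q, K_N) are pairwise distinct. Fix k with 1 ≤ k ≤ N and p ∈ [0, 1). Then there exists a threshold ε < 1 such that for every nonzero Q' ∈ E with cos(Q, Q') > ε, the following holds: letting S be the (unique) top-k index set for Q and S' any top-k index set for Q', one has |S ∩ S'| / |S| > p. -/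
open RealInnerProductSpace

/-- The cosine similarity of two vectors in a real inner product space. -/
noncomputable def cosSim {E : Type*} [NormedAddCommGroup E] [InnerProductSpace ℝ E]
    (u v : E) : ℝ :=
  ⟪u, v⟫ / (‖u‖ * ‖v‖)

/-- `S` is a top-`k` index set for the query `v` with respect to the keys `K`:
`S` has cardinality `k` and every index in `S` has cosine similarity with `v` at least
that of every index outside `S`. -/
def IsTopK {E : Type*} [NormedAddCommGroup E] [InnerProductSpace ℝ E] {N : ℕ}
    (K : Fin N → E) (k : ℕ) (v : E) (S : Finset (Fin N)) : Prop :=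
  S.card = k ∧ ∀ i ∈ S, ∀ j ∉ S, cosSim v (K j) ≤ cosSim v (K i)

theorem cosSim_eq_inner_smul {E : Type*} [NormedAddCommGroup E] [InnerProductSpace ℝ E]
    (u v : E) : cosSim u v = ⟪‖u‖⁻¹ • u, ‖v‖⁻¹ • v⟫ := by
  rw [cosSim, real_inner_smul_left, real_inner_smul_right, div_eq_mul_inv, mul_inv]
  ring

/-- Cosine similarity with a fixed vector is Lipschitz in the chordal distance between
directions. -/
theorem sq_cosSim_sub_cosSim_le {E : Type*} [NormedAddCommGroup E] [InnerProductSpace ℝ E]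
    {u v : E} (hu : u ≠ 0) (hv : v ≠ 0) (w : E) :
    (cosSim u w - cosSim v w) ^ 2 ≤ 2 * (1 - cosSim u v) := by
  have norm_w : ‖‖w‖⁻¹ • w‖ ≤ 1 := by
    rw [norm_smul, norm_inv, norm_norm]
    exact inv_mul_le_one
  have norm_u : ‖‖u‖⁻¹ • u‖ = 1 := norm_smul_inv_norm (𝕜 := ℝ) hu
  have norm_v : ‖‖v‖⁻¹ • v‖ = 1 := norm_smul_inv_norm (𝕜 := ℝ) hv
  have hsq := norm_sub_sq_real (‖u‖⁻¹ • u) (‖v‖⁻¹ • v)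
  rw [norm_u, norm_v] at hsq
  simp only [cosSim_eq_inner_smul]
  rw [← inner_sub_left]
  calc ⟪‖u‖⁻¹ • u - ‖v‖⁻¹ • v, ‖w‖⁻¹ • w⟫ ^ 2
      ≤ ‖‖u‖⁻¹ • u - ‖v‖⁻¹ • v‖ ^ 2 :=
        sq_le_sq.2 <| ((abs_real_inner_le_norm _ _).trans
          (mul_le_of_le_one_right (norm_nonneg _) norm_w)).trans (le_abs_self _)
    _ = 2 * (1 - ⟪‖u‖⁻¹ • u, ‖v‖⁻¹ • v⟫) := by rw [hsq]; ring

/-- A finite injective real family is uniformly separated. -/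
theorem exists_pos_forall_le_abs_sub {ι : Type*} [Finite ι] {c : ι → ℝ}
    (hc : ∀ i j, i ≠ j → c i ≠ c j) :
    ∃ δ : ℝ, 0 < δ ∧ ∀ i j, i ≠ j → δ ≤ |c i - c j| := by
  have h : ∀ᶠ δ in nhdsWithin (0 : ℝ) (Set.Ioi 0), ∀ i j, i ≠ j → δ ≤ |c i - c j| := by
    simp only [Filter.eventually_all]
    intro i j hij
    exact nhdsWithin_le_nhds (Iic_mem_nhds (abs_pos.2 (sub_ne_zero.2 (hc i j hij))))
  obtain ⟨δ, hδ, hpos⟩ := (h.and self_mem_nhdsWithin).exists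
  exact ⟨δ, hpos, hδ⟩

/-- Queries whose similarities to the keys differ by less than half the separation `δ` have the
same top-`k` index sets. -/
theorem IsTopK.eq_of_abs_sub_lt {E : Type*} [NormedAddCommGroup E] [InnerProductSpace ℝ E]
    {N k : ℕ} {K : Fin N → E} {u v : E} {S T : Finset (Fin N)} {δ : ℝ}
    (hS : IsTopK K k u S) (hT : IsTopK K k v T)
    (hsep : ∀ i j, i ≠ j → δ ≤ |cosSim u (K i) - cosSim u (K j)|)
    (hclose : ∀ i, |cosSim u (K i) - cosSim v (K i)| < δ / 2) : S = T := by
  by_contra hne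
  have hcard : S.card = T.card := hS.1.trans hT.1.symm
  obtain ⟨i, hiS, hiT⟩ := Finset.not_subset.1 fun h =>
    hne (Finset.eq_of_subset_of_card_le h hcard.ge)
  obtain ⟨j, hjT, hjS⟩ := Finset.not_subset.1 fun h =>
    hne (Finset.eq_of_subset_of_card_le h hcard.le).symm
  have hu := hS.2 i hiS j hjS
  have hv := hT.2 j hjT i hiT
  have hij := hsep i j fun h => hjS (h ▸ hiS)
  rw [abs_of_nonneg (sub_nonneg.2 hu)] at hij
  have hi := abs_lt.1 (hclose i)
  have hj := abs_lt.1 (hclose j)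
  linarith [hi.2, hj.1]

/-- Given nonzero keys `K₁, …, K_N` and a nonzero query `Q` with pairwise distinct cosine
similarities, for every `1 ≤ k ≤ N` and `p ∈ [0, 1)` there is a threshold `ε < 1` such that
every nonzero `Q'` with `cos(Q, Q') > ε` has top-`k` index sets overlapping the (unique)
top-`k` index set of `Q` in ratio greater than `p`. -/
theorem exists_threshold_topK_overlap {E : Type*} [NormedAddCommGroup E]
    [InnerProductSpace ℝ E] {N : ℕ}
    (K : Fin N → E) (hK : ∀ i, K i ≠ 0) (Q : E) (hQ : Q ≠ 0)
    (hdist : ∀ i j : Fin N, i ≠ j → cosSim Q (K i) ≠ cosSim Q (K j))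
    (k : ℕ) (hk1 : 1 ≤ k) (hkN : k ≤ N) (p : ℝ) (hp0 : 0 ≤ p) (hp1 : p < 1) :
    ∃ ε : ℝ, ε < 1 ∧ ∀ Q' : E, Q' ≠ 0 → cosSim Q Q' > ε →
      ∀ S S' : Finset (Fin N), IsTopK K k Q S → IsTopK K k Q' S' →
        ((S ∩ S').card : ℝ) / (S.card : ℝ) > p := by
  obtain ⟨δ, hδ, hsep⟩ := exists_pos_forall_le_abs_sub hdist
  refine ⟨1 - δ ^ 2 / 8, by linarith [pow_pos hδ 2], ?_⟩
  intro Q' hQ' hcos S S' hS hS'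
  have hclose : ∀ i, |cosSim Q (K i) - cosSim Q' (K i)| < δ / 2 := fun i =>
    abs_lt_of_sq_lt_sq (by linarith [sq_cosSim_sub_cosSim_le hQ hQ' (K i), div_pow δ 2 2])
      (half_pos hδ).le
  obtain rfl := hS.eq_of_abs_sub_lt hS' hsep hclose
  have hne : (S.card : ℝ) ≠ 0 := by
    rw [hS.1]
    exact_mod_cast Nat.one_le_iff_ne_zero.1 hk1
  rwa [Finset.inter_self, div_self hne]
end
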